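/- Let D be a fixed n×n Metzler matrix, and for d ∈ ℝⁿ let A(d) := diag(d) + D. Then the map d ↦ s(A(d)) (stability modulus) is convex on ℝⁿ. -/

import Mathlib

/-- The stability modulus of a real square matrix: the maximal real part of its
(complex) eigenvalues. -/
noncomputable def stabModulus {n : ℕ} (A : Matrix (Fin n) (Fin n) ℝ) : ℝ :=
  sSup (Complex.re '' spectrum ℂ (A.map Complex.ofReal))

open Matrix Filter

lemma aux_mem_spec {n : ℕ} (A : Matrix (Fin n) (Fin n) ℂ) (μ : ℂ) (h : μ ∈ spectrum ℂ A) :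
    ∃ v : Fin n → ℂ, v ≠ 0 ∧ A *ᵥ v = μ • v := by
  rw [← Matrix.spectrum_toLin', ← Module.End.hasEigenvalue_iff_mem_spectrum] at h
  obtain ⟨v, hv⟩ := h.exists_hasEigenvector
  exact ⟨v, hv.2, by simpa using hv.apply_eq_smul⟩

lemma aux_upper {n : ℕ} (A : Matrix (Fin n) (Fin n) ℝ) (hA : ∀ i j, i ≠ j → 0 ≤ A i j)
    (x : Fin n → ℝ) (hx : ∀ i, 0 < x i) (t : ℝ) (h : ∀ i, (A *ᵥ x) i ≤ t * x i)
    (μ : ℂ) (hμ : μ ∈ spectrum ℂ (A.map Complex.ofReal)) : μ.re ≤ t := by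
  obtain ⟨v, hv0, hv⟩ := aux_mem_spec _ μ hμ
  obtain ⟨k, hk⟩ := Function.ne_iff.mp hv0
  have : Nonempty (Fin n) := ⟨k⟩
  obtain ⟨i, hi⟩ := Finite.exists_max (fun i => ‖v i‖ / x i)
  have hvi : 0 < ‖v i‖ / x i :=
    lt_of_lt_of_le (div_pos (norm_pos_iff.mpr hk) (hx k)) (hi k)
  set m := ‖v i‖ / x i with hm
  have hvi' : ‖v i‖ = m * x i := by rw [hm]; field_simp [(hx i).ne']
  have hvj : ∀ j, ‖v j‖ ≤ m * x j := fun j => (div_le_iff₀ (hx j)).mp (hi j)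
  have e := congrFun hv i
  simp only [Matrix.mulVec, dotProduct, Matrix.map_apply, Pi.smul_apply, smul_eq_mul] at e
  have h1 := h i
  simp only [Matrix.mulVec, dotProduct] at h1
  rw [← Finset.add_sum_erase _ _ (Finset.mem_univ i)] at e h1
  have e2 : (μ - A i i) * v i = ∑ j ∈ Finset.univ.erase i, (A i j : ℂ) * v j := by
    linear_combination -e
  have e3 : ‖μ - A i i‖ * ‖v i‖ ≤ m * ∑ j ∈ Finset.univ.erase i, A i j * x j := by
    rw [← norm_mul, e2, Finset.mul_sum]
    refine (norm_sum_le _ _).trans (Finset.sum_le_sum fun j hj => ?_)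
    have h0 := hA i j (Finset.ne_of_mem_erase hj).symm
    rw [norm_mul, Complex.norm_real, Real.norm_of_nonneg h0]
    nlinarith [hvj j, mul_le_mul_of_nonneg_left (hvj j) h0]
  have e4 : (μ.re - A i i) ≤ ‖μ - A i i‖ := by
    simpa using Complex.re_le_norm (μ - A i i)
  have e5 : ‖μ - A i i‖ * (m * x i) ≤ (t - A i i) * (m * x i) := by
    rw [hvi'] at e3
    nlinarith [mul_le_mul_of_nonneg_left h1 hvi.le]
  have := le_of_mul_le_mul_right e5 (mul_pos hvi (hx i))
  linarith

section
attribute [local instance] Matrix.linftyOpNormedRing Matrix.linftyOpNormedAlgebra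

lemma aux_gelfand {n : ℕ} (C : Matrix (Fin n) (Fin n) ℂ) (r : NNReal) (hr : 0 < r)
    (h : ∀ μ ∈ spectrum ℂ C, ‖μ‖₊ < r) [Nonempty (Fin n)] :
    ∃ N : ℕ, 0 < N ∧ ∀ i, ∑ j, ‖(C ^ N) i j‖ ≤ (r : ℝ) ^ N := by
  have : CompleteSpace (Matrix (Fin n) (Fin n) ℂ) := FiniteDimensional.complete ℂ _
  have hs : spectralRadius ℂ C < r :=
    spectrum.spectralRadius_lt_of_forall_lt_of_nonempty (spectrum.nonempty C) h
  have hg := spectrum.pow_nnnorm_pow_one_div_tendsto_nhds_spectralRadius C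
  obtain ⟨N, hN, hN0⟩ := ((hg.eventually (gt_mem_nhds hs)).and (eventually_gt_atTop 0)).exists
  refine ⟨N, hN0, fun i => ?_⟩
  have h2 : ‖C ^ N‖₊ < r ^ N := by
    have := ENNReal.rpow_lt_rpow hN (show (0:ℝ) < N by exact_mod_cast hN0)
    rw [← ENNReal.rpow_mul, one_div, inv_mul_cancel₀ (by positivity), ENNReal.rpow_one,
      ENNReal.rpow_natCast] at this
    exact_mod_cast this
  have h3 : ∑ j, ‖(C ^ N) i j‖₊ ≤ ‖C ^ N‖₊ := by
    rw [Matrix.linfty_opNNNorm_def]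
    exact Finset.le_sup (f := fun i => ∑ j, ‖(C ^ N) i j‖₊) (Finset.mem_univ i)
  have h4 := NNReal.coe_le_coe.mpr (h3.trans h2.le)
  rw [NNReal.coe_sum, NNReal.coe_pow] at h4
  exact h4
end

lemma aux_shift (S : Set ℂ) (hS : S.Finite) (t : ℝ) (h : ∀ μ ∈ S, μ.re < t) :
    ∀ᶠ c : ℝ in atTop, ∀ μ ∈ S, ‖μ + c‖ < t + c := by
  rw [Filter.eventually_all_finite hS]
  intro μ hμ
  have h1 := h μ hμ
  have : Tendsto (fun c : ℝ => (t - μ.re) * (t + μ.re + 2 * c)) atTop atTop := by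
    apply Tendsto.const_mul_atTop (by linarith)
    apply tendsto_atTop_add_const_left
    exact Tendsto.const_mul_atTop (by norm_num) tendsto_id
  filter_upwards [this.eventually_gt_atTop (μ.im ^ 2), eventually_gt_atTop (-t)] with c hc hc2
  apply lt_of_pow_lt_pow_left₀ 2 (by linarith)
  rw [Complex.sq_norm, Complex.normSq_apply]
  simp
  nlinarith

lemma aux_lower {n : ℕ} [Nonempty (Fin n)] (A : Matrix (Fin n) (Fin n) ℝ)
    (hA : ∀ i j, i ≠ j → 0 ≤ A i j) (t : ℝ)
    (ht : ∀ μ ∈ spectrum ℂ (A.map Complex.ofReal), μ.re < t) :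
    ∃ x : Fin n → ℝ, (∀ i, 0 < x i) ∧ ∀ i, (A *ᵥ x) i ≤ t * x i := by
  have hfin : (spectrum ℂ (A.map Complex.ofReal)).Finite := Matrix.finite_spectrum _
  have hd : ∀ᶠ c : ℝ in atTop, ∀ i, 0 ≤ c + A i i := by
    rw [Filter.eventually_all]
    intro i
    filter_upwards [eventually_ge_atTop (-A i i)] with c hc
    linarith
  obtain ⟨c, ⟨hc, hcd⟩, hct⟩ :=
    (((aux_shift _ hfin t ht).and hd).and (eventually_gt_atTop (-t))).exists
  set r : ℝ := t + c with hr
  have hr0 : 0 < r := by linarith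
  set B : Matrix (Fin n) (Fin n) ℝ := A + c • 1 with hB
  have hB0 : ∀ i j, 0 ≤ B i j := by
    intro i j
    by_cases hij : i = j
    · subst hij; simpa [hB, add_comm] using hcd i
    · simpa [hB, hij] using hA i j hij
  have hBm : B.map Complex.ofReal = algebraMap ℂ _ (c : ℂ) + A.map Complex.ofReal := by
    ext i j
    by_cases hij : i = j
    · subst hij; simp [hB, Matrix.algebraMap_matrix_apply, add_comm]
    · simp [hB, hij, Matrix.algebraMap_matrix_apply]
  have hBpow : ∀ N, (B.map Complex.ofReal) ^ N = (B ^ N).map Complex.ofReal := by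
    intro N
    exact (map_pow (Complex.ofRealHom.mapMatrix (m := Fin n)) B N).symm
  have hspec : ∀ μ ∈ spectrum ℂ (B.map Complex.ofReal), ‖μ‖₊ < (⟨r, hr0.le⟩ : NNReal) := by
    intro μ hμ
    have h1 : μ - c ∈ spectrum ℂ (A.map Complex.ofReal) := by
      rw [hBm, ← spectrum.singleton_add_eq] at hμ
      obtain ⟨a, ha, b, hb, hab⟩ := hμ
      rw [Set.mem_singleton_iff] at ha
      subst ha
      simp only at hab
      rw [← hab]; simpa using hb
    have := hc _ h1
    rw [sub_add_cancel] at this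
    exact this
  obtain ⟨N, hN0, hN⟩ := aux_gelfand (B.map Complex.ofReal) ⟨r, hr0.le⟩ hr0 hspec
  have hpow0 : ∀ k i j, 0 ≤ (B ^ k) i j := by
    intro k
    induction k with
    | zero => intro i j; rw [pow_zero, Matrix.one_apply]; split_ifs <;> norm_num
    | succ k ih =>
      intro i j
      rw [pow_succ, Matrix.mul_apply]
      exact Finset.sum_nonneg fun l _ => mul_nonneg (ih i l) (hB0 l j)
  have hN' : ∀ i, ((B ^ N) *ᵥ 1) i ≤ r ^ N := by
    intro i
    refine le_trans (le_of_eq ?_) (hN i)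
    rw [hBpow]
    simp only [Matrix.mulVec, dotProduct, Matrix.map_apply, Complex.norm_real, Pi.one_apply, mul_one]
    exact Finset.sum_congr rfl fun j _ => (Real.norm_of_nonneg (hpow0 N i j)).symm
  -- `y k = (B/r)^k 1`
  let y : ℕ → Fin n → ℝ := fun k => (r ^ k)⁻¹ • ((B ^ k) *ᵥ 1)
  have hy0 : ∀ k i, 0 ≤ y k i := by
    intro k i
    simp only [y, Pi.smul_apply, smul_eq_mul, Matrix.mulVec, dotProduct, Pi.one_apply, mul_one]
    exact mul_nonneg (by positivity) (Finset.sum_nonneg fun j _ => hpow0 k i j)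
  have hyz : ∀ i, y 0 i = 1 := by intro i; simp [y]
  have hyN : ∀ i, y N i ≤ 1 := by
    intro i
    simp only [y, Pi.smul_apply, smul_eq_mul]
    rw [inv_mul_le_iff₀ (by positivity), mul_one]
    exact hN' i
  have hys : ∀ k, B *ᵥ y k = r • y (k + 1) := by
    intro k
    simp only [y]
    rw [Matrix.mulVec_smul, Matrix.mulVec_mulVec, ← pow_succ', smul_smul]
    congr 1
    field_simp
    ring
  refine ⟨∑ k ∈ Finset.range N, y k, fun i => ?_, fun i => ?_⟩
  · rw [Finset.sum_apply]
    refine Finset.sum_pos' (fun k _ => hy0 k i) ⟨0, Finset.mem_range.mpr hN0, ?_⟩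
    rw [hyz]; norm_num
  · set x := ∑ k ∈ Finset.range N, y k with hx
    have h1 : B *ᵥ x = r • ∑ k ∈ Finset.range N, y (k + 1) := by
      rw [hx, Matrix.mulVec_sum, Finset.smul_sum]
      exact Finset.sum_congr rfl fun k _ => hys k
    have h2 : ∑ k ∈ Finset.range N, y (k + 1) = x + y N - y 0 := by
      rw [hx, ← Finset.sum_range_succ, Finset.sum_range_succ']; simp
    have h3 : (B *ᵥ x) i = (A *ᵥ x) i + c * x i := by
      simp [hB, Matrix.add_mulVec, Matrix.smul_mulVec]
    have h4 : (B *ᵥ x) i = r * (x i + y N i - y 0 i) := by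
      rw [h1, h2]; simp
    have h5 := hyN i
    rw [hyz] at h4
    nlinarith

lemma aux_comb {n : ℕ} (D : Matrix (Fin n) (Fin n) ℝ) (hD : ∀ i j, i ≠ j → 0 ≤ D i j)
    (d e : Fin n → ℝ) (a b : ℝ) (ha : 0 ≤ a) (hb : 0 ≤ b) (hab : a + b = 1) (s t : ℝ)
    (x y : Fin n → ℝ) (hx0 : ∀ i, 0 < x i) (hy0 : ∀ i, 0 < y i)
    (hx : ∀ i, ((diagonal d + D) *ᵥ x) i ≤ s * x i)
    (hy : ∀ i, ((diagonal e + D) *ᵥ y) i ≤ t * y i) :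
    ∃ z : Fin n → ℝ, (∀ i, 0 < z i) ∧
      ∀ i, ((diagonal (a • d + b • e) + D) *ᵥ z) i ≤ (a * s + b * t) * z i := by
  have hz0 : ∀ i, 0 < x i ^ a * y i ^ b := fun i =>
    mul_pos (Real.rpow_pos_of_pos (hx0 i) _) (Real.rpow_pos_of_pos (hy0 i) _)
  refine ⟨fun i => x i ^ a * y i ^ b, hz0, fun i => ?_⟩
  have hx' := hx i
  have hy' := hy i
  have key : ∀ (f w : Fin n → ℝ), ((diagonal f + D) *ᵥ w) i
      = f i * w i + (D i i * w i + ∑ j ∈ Finset.univ.erase i, D i j * w j) := by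
    intro f w
    rw [Finset.add_sum_erase _ (fun j => D i j * w j) (Finset.mem_univ i), Matrix.add_mulVec, Pi.add_apply,
      Matrix.mulVec_diagonal]
    rfl
  rw [key] at hx' hy' ⊢
  set X := ∑ j ∈ Finset.univ.erase i, D i j * x j with hX
  set Y := ∑ j ∈ Finset.univ.erase i, D i j * y j with hY
  set z := x i ^ a * y i ^ b with hz
  have hzi : 0 < z := hz0 i
  have hsum : ∑ j ∈ Finset.univ.erase i, D i j * (x j ^ a * y j ^ b)
      ≤ z * (a * (X / x i) + b * (Y / y i)) := by
    have : z * (a * (X / x i) + b * (Y / y i)) =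
        ∑ j ∈ Finset.univ.erase i, D i j * (z * (a * (x j / x i) + b * (y j / y i))) := by
      rw [hX, hY, Finset.sum_div, Finset.sum_div, Finset.mul_sum, Finset.mul_sum,
        ← Finset.sum_add_distrib, Finset.mul_sum]
      exact Finset.sum_congr rfl fun j _ => by ring
    rw [this]
    refine Finset.sum_le_sum fun j hj => ?_
    refine mul_le_mul_of_nonneg_left ?_ (hD i j (Finset.ne_of_mem_erase hj).symm)
    have g := Real.geom_mean_le_arith_mean2_weighted ha hb (div_pos (hx0 j) (hx0 i)).le
      (div_pos (hy0 j) (hy0 i)).le hab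
    rw [Real.div_rpow (hx0 j).le (hx0 i).le, Real.div_rpow (hy0 j).le (hy0 i).le,
      div_mul_div_comm, div_le_iff₀ hzi] at g
    linarith
  have hX' : X / x i ≤ s - d i - D i i := by
    rw [div_le_iff₀ (hx0 i)]; linarith
  have hY' : Y / y i ≤ t - e i - D i i := by
    rw [div_le_iff₀ (hy0 i)]; linarith
  have h6 : z * (a * (X / x i) + b * (Y / y i)) ≤
      z * (a * (s - d i - D i i) + b * (t - e i - D i i)) := by gcongr
  have h7 : z * (a * (s - d i - D i i) + b * (t - e i - D i i)) =
      (a * s + b * t) * z - (a * d i + b * e i) * z - D i i * z := by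
    linear_combination (-(z * D i i)) * hab
  simp only [Pi.add_apply, Pi.smul_apply, smul_eq_mul]
  linarith

lemma aux_lt {n : ℕ} (A : Matrix (Fin n) (Fin n) ℝ) (t : ℝ) (h : stabModulus A < t) :
    ∀ μ ∈ spectrum ℂ (A.map Complex.ofReal), μ.re < t := by
  intro μ hμ
  refine lt_of_le_of_lt (le_csSup ?_ (Set.mem_image_of_mem _ hμ)) h
  exact ((Matrix.finite_spectrum _).image _).bddAbove

/-- For a fixed Metzler matrix `D`, the map `d ↦ s(diag(d) + D)` is convex. -/
theorem stmt11 {n : ℕ} (D : Matrix (Fin n) (Fin n) ℝ)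
    (hD : ∀ i j, i ≠ j → 0 ≤ D i j) :
    ConvexOn ℝ Set.univ
      (fun d : Fin n → ℝ => stabModulus (Matrix.diagonal d + D)) := by
  refine ⟨convex_univ, ?_⟩
  intro d _ e _ a b ha hb hab
  simp only [smul_eq_mul]
  rcases Nat.eq_zero_or_pos n with hn | hn
  · subst hn
    rw [Subsingleton.elim (a • d + b • e) e, Subsingleton.elim d e, ← add_mul, hab, one_mul]
  have : Nonempty (Fin n) := ⟨⟨0, hn⟩⟩
  have hM : ∀ f : Fin n → ℝ, ∀ i j, i ≠ j → 0 ≤ (diagonal f + D) i j := by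
    intro f i j hij
    simpa [hij] using hD i j hij
  apply le_of_forall_pos_le_add
  intro ε hε
  obtain ⟨x, hx0, hx⟩ := aux_lower _ (hM d) (stabModulus (diagonal d + D) + ε)
    (aux_lt _ _ (by linarith))
  obtain ⟨y, hy0, hy⟩ := aux_lower _ (hM e) (stabModulus (diagonal e + D) + ε)
    (aux_lt _ _ (by linarith))
  obtain ⟨z, hz0, hz⟩ := aux_comb D hD d e a b ha hb hab _ _ x y hx0 hy0 hx hy
  have hne : (spectrum ℂ ((diagonal (a • d + b • e) + D).map Complex.ofReal)).Nonempty :=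
    spectrum.nonempty_of_isAlgClosed_of_finiteDimensional ℂ _
  refine csSup_le (hne.image _) ?_
  rintro _ ⟨μ, hμ, rfl⟩
  have := aux_upper _ (hM _) z hz0 _ hz μ hμ
  have h8 : a * ε + b * ε = ε := by rw [← add_mul, hab, one_mul]
  linarith
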